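/- Let P : {0,1}^n → ℝ with P(0) = 0 and multilinear coefficients (a_S)_{∅ ≠ S ⊆ {1,…,n}}, and suppose all coefficients of degree at least three are nonnegative: a_S ≥ 0 whenever |S| ≥ 3. Then P is submodular if and only if for every pair of distinct indices i, j one has a_{{i,j}} + Σ_{S : {i,j} ⊊ S} a_S ≤ 0. -/

import Mathlib

/-- A function of Boolean vectors is submodular if
`f(x ∧ y) + f(x ∨ y) ≤ f(x) + f(y)` for all `x, y`. -/
def Submodular {n : ℕ} (f : (Fin n → Bool) → ℝ) : Prop :=
  ∀ x y : Fin n → Bool, f (x ⊓ y) + f (x ⊔ y) ≤ f x + f y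

/-- A Boolean monomial is the indicator of its support being contained in the vector. -/
theorem prod_toNat_eq_ite {ι : Type*} (S : Finset ι) (x : ι → Bool) :
    ∏ i ∈ S, ((x i).toNat : ℝ) = if ∀ i ∈ S, x i = true then 1 else 0 := by
  split_ifs with h
  · exact Finset.prod_eq_one fun i hi => by simp [h i hi]
  · push Not at h
    obtain ⟨i, hi, hx⟩ := h
    exact Finset.prod_eq_zero hi (by simp [hx])

/-- The sum over all finsets containing `i` and `j`, with the pair itself split off. -/
theorem sum_supersets_pair {ι : Type*} [Fintype ι] [DecidableEq ι] (a : Finset ι → ℝ) (i j : ι) :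
    a {i, j} + ∑ S ∈ Finset.univ.filter (fun S : Finset ι => ({i, j} : Finset ι) ⊂ S), a S =
      ∑ S : Finset ι, if i ∈ S ∧ j ∈ S then a S else 0 := by
  rw [← Finset.sum_filter]
  have h : Finset.univ.filter (fun S : Finset ι => i ∈ S ∧ j ∈ S) =
      insert {i, j} (Finset.univ.filter (fun S : Finset ι => ({i, j} : Finset ι) ⊂ S)) := by
    ext S
    have hS : ({i, j} : Finset ι) ⊆ S ↔ i ∈ S ∧ j ∈ S := by
      simp [Finset.insert_subset_iff]
    simp only [Finset.mem_filter, Finset.mem_univ, true_and, Finset.mem_insert, ← hS]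
    rw [eq_comm]
    exact le_iff_eq_or_lt
  rw [h, Finset.sum_insert (by simp)]

/-- The submodularity defect of a monomial is `1` if its support lies below `x ⊔ y` but neither
below `x` nor below `y`, and `0` otherwise. -/
theorem monomial_defect {ι : Type*} (S : Finset ι) (x y : ι → Bool) :
    ∏ i ∈ S, (((x ⊓ y) i).toNat : ℝ) + ∏ i ∈ S, (((x ⊔ y) i).toNat : ℝ)
      - ∏ i ∈ S, ((x i).toNat : ℝ) - ∏ i ∈ S, ((y i).toNat : ℝ) =
    if (∀ i ∈ S, (x ⊔ y) i = true) ∧ (¬ ∀ i ∈ S, x i = true) ∧ (¬ ∀ i ∈ S, y i = true)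
      then 1 else 0 := by
  simp only [prod_toNat_eq_ite]
  have hinf : (∀ i ∈ S, (x ⊓ y) i = true) ↔ (∀ i ∈ S, x i = true) ∧ ∀ i ∈ S, y i = true := by
    simp [forall_and]
  have hx : (∀ i ∈ S, x i = true) → ∀ i ∈ S, (x ⊔ y) i = true := fun h i hi => by simp [h i hi]
  have hy : (∀ i ∈ S, y i = true) → ∀ i ∈ S, (x ⊔ y) i = true := fun h i hi => by simp [h i hi]
  rw [if_congr hinf rfl rfl]
  by_cases h1 : ∀ i ∈ S, x i = true
  · by_cases h2 : ∀ i ∈ S, y i = true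
    · rw [if_pos ⟨h1, h2⟩, if_pos (hx h1), if_pos h1, if_pos h2, if_neg (fun h => h.2.1 h1)]
      norm_num
    · rw [if_neg (fun h => h2 h.2), if_pos (hx h1), if_pos h1, if_neg h2,
        if_neg (fun h => h.2.1 h1)]
      norm_num
  · rw [if_neg (fun h => h1 h.1), if_neg h1]
    by_cases h2 : ∀ i ∈ S, y i = true
    · rw [if_pos (hy h2), if_pos h2, if_neg (fun h => h.2.2 h2)]
      norm_num
    · rw [if_neg h2, if_congr (and_iff_left ⟨h1, h2⟩) rfl rfl]
      ring

/-- The submodularity defect of a Boolean polynomial in terms of its coefficients. -/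
theorem polynomial_defect {ι : Type*} [Fintype ι] (P : (ι → Bool) → ℝ)
    (a : Finset ι → ℝ)
    (hP : ∀ x, P x = ∑ S : Finset ι, a S * ∏ i ∈ S, ((x i).toNat : ℝ)) (x y : ι → Bool) :
    P (x ⊓ y) + P (x ⊔ y) - P x - P y =
      ∑ S : Finset ι, if (∀ i ∈ S, (x ⊔ y) i = true) ∧ (¬ ∀ i ∈ S, x i = true) ∧
        (¬ ∀ i ∈ S, y i = true) then a S else 0 := by
  simp only [hP, ← Finset.sum_add_distrib, ← Finset.sum_sub_distrib]
  refine Finset.sum_congr rfl fun S _ => ?_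
  rw [← mul_add, ← mul_sub, ← mul_sub, monomial_defect, mul_ite, mul_one, mul_zero]

/-- The defect contributed by one coefficient is at most that coefficient counted once for each
pair in its support separating `x` and `y`. -/
theorem coefficient_defect_le {ι : Type*} [Fintype ι] [DecidableEq ι] (x y : ι → Bool)
    (S : Finset ι) (c : ℝ) (hc : 3 ≤ S.card → 0 ≤ c) :
    (if (∀ i ∈ S, (x ⊔ y) i = true) ∧ (¬ ∀ i ∈ S, x i = true) ∧ (¬ ∀ i ∈ S, y i = true)
      then c else 0) ≤
    ∑ p : ι × ι with (x p.1 = true ∧ y p.1 = false) ∧ (y p.2 = true ∧ x p.2 = false),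
      if p.1 ∈ S ∧ p.2 ∈ S then c else 0 := by
  have exists_pair : (∀ i ∈ S, (x ⊔ y) i = true) ∧ (¬ ∀ i ∈ S, x i = true) ∧
      (¬ ∀ i ∈ S, y i = true) → ∃ i ∈ S, ∃ j ∈ S,
        (x i = true ∧ y i = false) ∧ (y j = true ∧ x j = false) := by
    rintro ⟨h, hx, hy⟩
    push Not at hx hy
    obtain ⟨j, hj, hxj⟩ := hx
    obtain ⟨i, hi, hyi⟩ := hy
    have h1 := h i hi
    have h2 := h j hj
    simp only [Pi.sup_apply] at h1 h2
    refine ⟨i, hi, j, hj, ?_⟩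
    simp_all
  by_cases hS : 3 ≤ S.card
  · have hc := hc hS
    have nonneg : ∀ p : ι × ι, 0 ≤ if p.1 ∈ S ∧ p.2 ∈ S then c else 0 := fun p => by
      split_ifs <;> simp [hc]
    split_ifs with h
    · obtain ⟨i, hi, j, hj, hij⟩ := exists_pair h
      refine le_trans ?_ (Finset.single_le_sum (fun p _ => nonneg p)
        (Finset.mem_filter.2 ⟨Finset.mem_univ (i, j), hij⟩))
      simp [hi, hj]
    · exact Finset.sum_nonneg fun p _ => nonneg p
  · by_cases h : ∃ i ∈ S, ∃ j ∈ S, (x i = true ∧ y i = false) ∧ (y j = true ∧ x j = false)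
    · obtain ⟨i, hi, j, hj, hij⟩ := h
      have hne : i ≠ j := by
        rintro rfl
        exact Bool.false_ne_true (hij.1.2.symm.trans hij.2.1)
      have hSeq : S = {i, j} := by
        refine (Finset.eq_of_subset_of_card_le (by simp [Finset.insert_subset_iff, hi, hj]) ?_).symm
        rw [Finset.card_pair hne]
        omega
      rw [Finset.sum_eq_single_of_mem (i, j) (Finset.mem_filter.2 ⟨Finset.mem_univ _, hij⟩)]
      · rw [if_pos, if_pos ⟨hi, hj⟩]
        simp [hSeq, hij]
      · rintro ⟨k, l⟩ hkl hkl_ne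
        rw [Finset.mem_filter] at hkl
        refine if_neg ?_
        rw [hSeq]
        simp only [Finset.mem_insert, Finset.mem_singleton]
        rintro ⟨rfl | rfl, rfl | rfl⟩ <;> simp_all
    · rw [if_neg (fun h' => h (exists_pair h')), Finset.sum_eq_zero]
      rintro ⟨i, j⟩ hij
      exact if_neg fun hm => h ⟨i, hm.1, j, hm.2, (Finset.mem_filter.1 hij).2⟩

/-- Remark: a Boolean polynomial `P` with `P(0) = 0`, multilinear
coefficients `a_S`, all of whose coefficients of degree at least three are
nonnegative, is submodular iff for every pair of distinct indices `i, j` one has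
`a_{{i,j}} + Σ_{S ⊋ {i,j}} a_S ≤ 0`. -/
theorem submodular_iff_pair_condition (n : ℕ) (P : (Fin n → Bool) → ℝ)
    (a : Finset (Fin n) → ℝ) (ha0 : a ∅ = 0)
    (hP : ∀ x : Fin n → Bool,
      P x = ∑ S : Finset (Fin n), a S * ∏ i ∈ S, ((x i).toNat : ℝ))
    (hdeg : ∀ S : Finset (Fin n), 3 ≤ S.card → 0 ≤ a S) :
    Submodular P ↔
      ∀ i j : Fin n, i ≠ j →
        a {i, j} +
          ∑ S ∈ Finset.univ.filter
            (fun S : Finset (Fin n) => ({i, j} : Finset (Fin n)) ⊂ S),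
            a S ≤ 0 := by
  simp only [sum_supersets_pair]
  constructor
  · intro h i j hij
    have hd := polynomial_defect P a hP (fun k => !decide (k = i)) (fun k => !decide (k = j))
    have hs := h (fun k => !decide (k = i)) (fun k => !decide (k = j))
    have heq : ∀ S : Finset (Fin n),
        ((∀ k ∈ S, ((fun k => !decide (k = i)) ⊔ (fun k => !decide (k = j)) : Fin n → Bool) k
          = true) ∧ (¬ ∀ k ∈ S, (!decide (k = i)) = true) ∧
          (¬ ∀ k ∈ S, (!decide (k = j)) = true)) ↔ i ∈ S ∧ j ∈ S := by
      intro S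
      have hsup : ∀ k ∈ S, ((fun k => !decide (k = i)) ⊔ (fun k => !decide (k = j)) :
          Fin n → Bool) k = true := by
        intro k _
        by_cases hk : k = i
        · subst hk
          simp [hij]
        · simp [hk]
      rw [and_iff_right hsup]
      simp
    simp only [heq] at hd
    linarith
  · intro h x y
    suffices P (x ⊓ y) + P (x ⊔ y) - P x - P y ≤ 0 by linarith
    rw [polynomial_defect P a hP]
    refine (Finset.sum_le_sum fun S _ => le_of_eq_of_le (by congr)
      (coefficient_defect_le x y S (a S) (hdeg S))).trans ?_
    rw [Finset.sum_comm]
    refine Finset.sum_nonpos fun p hp => h p.1 p.2 fun hpe => ?_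
    have := (Finset.mem_filter.1 hp).2
    simp_all
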